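/- For every real κ > 1, one has −2 − 4κ + 6κ² + (−1 − 2κ + 3κ²)·log κ + (1 − 2κ − 3κ²)·log(κ(3κ − 1)/(1 + κ)) > 0. -/

import Mathlib

theorem log_lt_aux (x : ℝ) (hx : 1 < x) : Real.log x < (x - x⁻¹) / 2 := by
  have h := Real.self_lt_sinh_iff.2 (Real.log_pos hx)
  rwa [Real.sinh_log (by linarith)] at h

theorem K_pos (κ : ℝ) (hκ : 1 < κ) :
    0 < -2 - 4 * κ + 6 * κ ^ 2 + (-1 - 2 * κ + 3 * κ ^ 2) * Real.log κ
      + (1 - 2 * κ - 3 * κ ^ 2) * Real.log (κ * (3 * κ - 1) / (1 + κ)) := by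
  have h0 : 0 < κ := by linarith
  have h1 : 0 < 1 + κ := by linarith
  have h2 : 0 < 3 * κ - 1 := by linarith
  have hy : 1 < (3 * κ - 1) / (1 + κ) := by
    rw [lt_div_iff₀ h1]; linarith
  have e : Real.log (κ * (3 * κ - 1) / (1 + κ))
      = Real.log κ + Real.log ((3 * κ - 1) / (1 + κ)) := by
    rw [mul_div_assoc, Real.log_mul h0.ne' (by positivity)]
  have a := mul_lt_mul_of_pos_left (log_lt_aux κ hκ) (by positivity : 0 < 4 * κ)
  have b := mul_lt_mul_of_pos_left (log_lt_aux _ hy) (mul_pos h2 h1)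
  have ea : 4 * κ * ((κ - κ⁻¹) / 2) = 2 * (κ ^ 2 - 1) := by
    field_simp; ring
  have eb : (3 * κ - 1) * (1 + κ) * (((3 * κ - 1) / (1 + κ) - ((3 * κ - 1) / (1 + κ))⁻¹) / 2)
      = 4 * κ * (κ - 1) := by
    have := h2.ne'
    rw [inv_div]; field_simp; ring
  rw [ea] at a
  rw [eb] at b
  rw [e]
  nlinarith [a, b]
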